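/- For every ε > 0 there exists a constant C(ε) > 0 depending only on ε such that for every positive integer Q, M(Q) ≤ C(ε) · Q^{1/2 + ε}, where M(Q) = max over x' ∈ S_Q of the number of x ∈ S_Q with 2‖x − x'‖ < Q^{−3}. -/

import Mathlib

open Finset Real
open scoped Classical

noncomputable def dist01 (x : ℝ) : ℝ := |x - round x|

noncomputable def SQ (Q : ℕ) : Finset ℚ :=
  (Finset.Ioc Q (2*Q)).biUnion fun q =>
    ((Finset.Ico 1 (q^2)).filter fun a => Nat.gcd a q = 1).image fun a : ℕ => (a : ℚ) / (q : ℚ)^2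

noncomputable def MQ (Q : ℕ) : ℕ :=
  (SQ Q).sup fun x' =>
    ((SQ Q).filter fun x => 2 * dist01 ((x : ℝ) - (x' : ℝ)) < 1/(Q:ℝ)^3).card

/-- The divisor bound. -/
lemma divisor_bound (ε : ℝ) (hε : 0 < ε) : ∃ C : ℝ, 0 < C ∧ ∀ n : ℕ, n ≠ 0 →
    (n.divisors.card : ℝ) ≤ C * (n : ℝ) ^ ε := by
  have hl2 : 0 < Real.log 2 := Real.log_pos (by norm_num)
  set K : ℝ := 1 + 1 / (ε * Real.log 2) with hK
  have hK1 : 1 ≤ K := by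
    have : 0 < 1 / (ε * Real.log 2) := by positivity
    linarith
  set P : ℕ := ⌈(2 : ℝ) ^ (1 / ε)⌉₊ with hP
  refine ⟨K ^ P, by positivity, fun n hn => ?_⟩
  have hlocal : ∀ p ∈ n.primeFactors, ((n.factorization p + 1 : ℕ) : ℝ) ≤
      (if p < P then K else 1) * ((p : ℝ) ^ (n.factorization p)) ^ ε := by
    intro p hp
    have hp2 : 2 ≤ p := (Nat.prime_of_mem_primeFactors hp).two_le
    have hp2' : (2 : ℝ) ≤ p := by exact_mod_cast hp2
    set k := n.factorization p
    have hcomm : ((p : ℝ) ^ k) ^ ε = ((p : ℝ) ^ ε) ^ k := by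
      rw [← Real.rpow_natCast, ← Real.rpow_natCast, ← Real.rpow_mul (by positivity),
        ← Real.rpow_mul (by positivity), mul_comm]
    split_ifs with h
    · have h1 : ((2 : ℝ) ^ ε) ^ k ≤ ((p : ℝ) ^ k) ^ ε := by
        rw [hcomm]
        gcongr
      have h2 : 1 + (k : ℝ) * (ε * Real.log 2) ≤ ((2 : ℝ) ^ ε) ^ k := by
        have h3 : 1 + ε * Real.log 2 ≤ (2 : ℝ) ^ ε := by
          rw [Real.rpow_def_of_pos (by norm_num)]
          have := Real.add_one_le_exp (Real.log 2 * ε)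
          linarith
        have h4 := one_add_mul_le_pow (a := ε * Real.log 2)
          (by have : 0 < ε * Real.log 2 := by positivity
              linarith) k
        have h5 : (1 + ε * Real.log 2) ^ k ≤ ((2 : ℝ) ^ ε) ^ k := by gcongr
        linarith
      have h6 : ((k + 1 : ℕ) : ℝ) ≤ K * (1 + (k : ℝ) * (ε * Real.log 2)) := by
        have h7 : 0 < ε * Real.log 2 := by positivity
        have : K * (1 + (k : ℝ) * (ε * Real.log 2))
            = 1 + k + 1 / (ε * Real.log 2) + k * (ε * Real.log 2) := by
          rw [hK]; field_simp; ring
        rw [this]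
        have : 0 < 1 / (ε * Real.log 2) := by positivity
        have : 0 ≤ k * (ε * Real.log 2) := by positivity
        push_cast
        linarith
      calc _ ≤ K * (1 + (k : ℝ) * (ε * Real.log 2)) := h6
        _ ≤ K * ((p : ℝ) ^ k) ^ ε := by
          gcongr
          linarith
    · rw [one_mul, hcomm]
      have h1 : (2 : ℝ) ^ (1 / ε) ≤ p := (Nat.le_ceil _).trans (by exact_mod_cast not_lt.mp h)
      have h2 : (2 : ℝ) ≤ (p : ℝ) ^ ε := by
        calc (2 : ℝ) = ((2 : ℝ) ^ (1 / ε)) ^ ε := by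
              rw [← Real.rpow_mul (by norm_num)]
              field_simp
              simp
          _ ≤ _ := by gcongr
      have h3 : k + 1 ≤ 2 ^ k := Nat.lt_two_pow_self
      calc ((k + 1 : ℕ) : ℝ) ≤ ((2 ^ k : ℕ) : ℝ) := by exact_mod_cast h3
        _ = (2 : ℝ) ^ k := by push_cast; rfl
        _ ≤ _ := by gcongr
  rw [Nat.card_divisors hn]
  have hprod : (n : ℝ) ^ ε = ∏ p ∈ n.primeFactors, ((p : ℝ) ^ (n.factorization p)) ^ ε := by
    rw [Real.finsetProd_rpow]
    · congr 1
      conv_lhs => rw [← Nat.prod_factorization_pow_eq_self hn]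
      rw [Finsupp.prod]
      push_cast
      rfl
    · intros; positivity
  push_cast
  calc ∏ p ∈ n.primeFactors, ((n.factorization p : ℝ) + 1)
      ≤ ∏ p ∈ n.primeFactors, ((if p < P then K else 1) *
          ((p : ℝ) ^ (n.factorization p)) ^ ε) := by
        apply Finset.prod_le_prod
        · intros; positivity
        · intro p hp
          have := hlocal p hp
          push_cast at this
          exact this
    _ = (∏ p ∈ n.primeFactors, (if p < P then K else 1)) * (n : ℝ) ^ ε := by
        rw [Finset.prod_mul_distrib, hprod]
    _ ≤ K ^ P * (n : ℝ) ^ ε := by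
        gcongr
        rw [Finset.prod_ite, Finset.prod_const, Finset.prod_const_one, mul_one]
        apply pow_le_pow_right₀ hK1
        calc _ ≤ (Finset.range P).card := Finset.card_le_card (by
              intro p hp
              simp only [Finset.mem_filter] at hp
              simpa using hp.2)
          _ = P := Finset.card_range P

/-- Combinatorial core. -/
lemma core (Q D : ℕ) (hQ : 0 < Q) (a r : ℤ) (hr1 : (Q : ℤ) ^ 2 < r) (hr2 : r ≤ 4 * (Q : ℤ) ^ 2)
    (hco : IsCoprime r a) (A : Finset ℕ) (hA : A ⊆ Finset.Ioc Q (2 * Q))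
    (hb : ∀ q ∈ A, ∃ b : ℤ, |b * r - a * (q : ℤ) ^ 2| * Q < 2 * r)
    (hD : ∀ n : ℕ, n ≠ 0 → n ≤ 4 * Q ^ 2 → n.divisors.card ≤ D) :
    A.card * A.card ≤ A.card + D * (288 * Q) := by
  have hQ' : (0 : ℤ) < Q := by exact_mod_cast hQ
  have hr0 : 0 < r := by nlinarith
  choose! b hb using hb
  set f : ℕ × ℕ → ℤ := fun p => (p.1 : ℤ) ^ 2 - (p.2 : ℤ) ^ 2 with hf
  have hrange : ∀ p ∈ A.offDiag, (Q : ℤ) < p.1 ∧ (p.1 : ℤ) ≤ 2 * Q ∧ (Q : ℤ) < p.2 ∧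
      (p.2 : ℤ) ≤ 2 * Q ∧ p.1 ≠ p.2 := by
    intro p hp
    rw [Finset.mem_offDiag] at hp
    have h1 := Finset.mem_Ioc.1 (hA hp.1)
    have h2 := Finset.mem_Ioc.1 (hA hp.2.1)
    refine ⟨?_, ?_, ?_, ?_, hp.2.2⟩ <;> [skip; skip; skip; skip] <;> omega
  have hfb : ∀ p ∈ A.offDiag, |f p| < 4 * (Q : ℤ) ^ 2 := by
    intro p hp
    obtain ⟨h1, h2, h3, h4, -⟩ := hrange p hp
    rw [abs_lt]
    simp only [hf]
    constructor <;> nlinarith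
  have hfne : ∀ p ∈ A.offDiag, f p ≠ 0 := by
    intro p hp h0
    obtain ⟨h1, h2, h3, h4, h5⟩ := hrange p hp
    have h6 : ((p.1 : ℤ) - p.2) * (p.1 + p.2) = 0 := by
      simp only [hf] at h0
      linarith
    rcases mul_eq_zero.1 h6 with h | h <;> omega
  -- fibres
  have hfib : ∀ n ∈ A.offDiag.image f, (A.offDiag.filter fun p => f p = n).card ≤ D := by
    intro n hn
    obtain ⟨p0, hp0, rfl⟩ := Finset.mem_image.1 hn
    have hn1 := hfb p0 hp0
    have hn0 := hfne p0 hp0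
    refine le_trans ?_ (hD (f p0).natAbs (by simpa using hn0) (by
      zify
      exact hn1.le))
    apply Finset.card_le_card_of_injOn (fun p => p.1 + p.2)
    · intro p hp
      have hp' := Finset.mem_filter.1 (Finset.mem_coe.1 hp)
      simp only [Finset.mem_coe, Nat.mem_divisors]
      refine ⟨?_, by simpa using hn0⟩
      rw [← Int.natCast_dvd, ← hp'.2]
      refine ⟨(p.1 : ℤ) - p.2, ?_⟩
      simp only [hf]
      push_cast
      ring
    · intro p hp p' hp' hpp
      have h1 := Finset.mem_filter.1 (Finset.mem_coe.1 hp)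
      have h2 := Finset.mem_filter.1 (Finset.mem_coe.1 hp')
      obtain ⟨g1, g2, g3, g4, g5⟩ := hrange p h1.1
      have h3 : f p = f p' := h1.2.trans h2.2.symm
      have h4 : (p.1 : ℤ) + p.2 = p'.1 + p'.2 := by exact_mod_cast hpp
      have h5 : ((p.1 : ℤ) + p.2) * (((p.1 : ℤ) - p.2) - (p'.1 - p'.2)) = 0 := by
        simp only [hf] at h3
        have : ((p.1 : ℤ) + p.2) * (p'.1 - p'.2) = (p'.1 : ℤ) ^ 2 - (p'.2 : ℤ) ^ 2 := by
          rw [h4]; ring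
        linarith
      rcases mul_eq_zero.1 h5 with h | h
      · omega
      · ext <;> omega
  -- image
  have himg : (A.offDiag.image f).card ≤ 288 * Q := by
    have hm : ∀ n ∈ A.offDiag.image f, ∃ c : ℤ, |c * r - a * n| < 16 * Q := by
      intro n hn
      obtain ⟨p, hp, rfl⟩ := Finset.mem_image.1 hn
      rw [Finset.mem_offDiag] at hp
      have h1 := hb _ hp.1
      have h2 := hb _ hp.2.1
      refine ⟨b p.1 - b p.2, ?_⟩
      have h3 : |(b p.1 - b p.2) * r - a * f p| ≤ |b p.1 * r - a * (p.1 : ℤ) ^ 2| +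
          |b p.2 * r - a * (p.2 : ℤ) ^ 2| := by
        have : (b p.1 - b p.2) * r - a * f p = (b p.1 * r - a * (p.1 : ℤ) ^ 2) -
          (b p.2 * r - a * (p.2 : ℤ) ^ 2) := by simp only [hf]; ring
        rw [this]
        exact abs_sub _ _
      by_contra hcon
      push Not at hcon
      nlinarith
    choose! c hc using hm
    have hcard : ((Finset.Ioo (-(16 * Q) : ℤ) (16 * Q)) ×ˢ (Finset.Icc (-4 : ℤ) 4)).card
        ≤ 288 * Q := by
      rw [Finset.card_product]
      simp only [Int.card_Ioo, Int.card_Icc]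
      have : ((4 : ℤ) + 1 - -4).toNat = 9 := by decide
      rw [this]
      omega
    refine le_trans ?_ hcard
    apply Finset.card_le_card_of_injOn (fun n => (c n * r - a * n, n / r))
    · intro n hn
      have hn' := Finset.mem_coe.1 hn
      have h1 := abs_lt.1 (hc n hn')
      obtain ⟨p, hp, hpn⟩ := Finset.mem_image.1 hn'
      have h2 := abs_lt.1 (hfb p hp)
      rw [hpn] at h2
      simp only [Finset.mem_coe, Finset.mem_product, Finset.mem_Ioo, Finset.mem_Icc]
      refine ⟨h1, ?_, ?_⟩
      · rw [Int.le_ediv_iff_mul_le hr0]; linarith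
      · have : n / r < 5 := by
          rw [Int.ediv_lt_iff_lt_mul hr0]; linarith
        omega
    · intro n hn n' hn' h
      simp only [Prod.mk.injEq] at h
      obtain ⟨h1, h2⟩ := h
      have h3 : r ∣ a * (n - n') := ⟨c n - c n', by linarith⟩
      have h4 : r ∣ n - n' := hco.dvd_of_dvd_mul_left h3
      have h5 : n % r = n' % r := (Int.emod_emod_of_dvd n (dvd_refl r)) ▸
        (Int.ModEq.symm ((Int.modEq_iff_dvd).2 h4)) ▸ by simp
      rw [← Int.mul_ediv_add_emod n r, ← Int.mul_ediv_add_emod n' r, h2, h5]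
  have hmain := Finset.card_le_mul_card_image A.offDiag D hfib
  rw [Finset.offDiag_card] at hmain
  have : D * (A.offDiag.image f).card ≤ D * (288 * Q) := Nat.mul_le_mul_left _ himg
  omega

/-- The frozen definition of `MQ` casts the finite set `SQ Q` to a finite set of reals through the
monad structure of `Finset`; this does not change cardinalities. -/
lemma card_filter_cast (s : Finset ℚ) (p : ℝ → Prop) :
    (Finset.filter p (do let a ← s; pure (a : ℝ))).card
      = (s.filter fun x : ℚ => p (x : ℝ)).card := by
  have h : (do let a ← s; pure (a : ℝ) : Finset ℝ) = s.image (fun x : ℚ => (x : ℝ)) := by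
    ext y
    simp [Finset.bind_def, Finset.pure_def, eq_comm]
  rw [h, Finset.filter_image, Finset.card_image_of_injective _ Rat.cast_injective]

lemma mem_SQ {Q : ℕ} {x : ℚ} (hx : x ∈ SQ Q) : ∃ q a : ℕ, Q < q ∧ q ≤ 2 * Q ∧ 1 ≤ a ∧ a < q ^ 2 ∧
    Nat.gcd a q = 1 ∧ x = (a : ℚ) / (q : ℚ) ^ 2 := by
  simp only [SQ, Finset.mem_biUnion, Finset.mem_image, Finset.mem_filter, Finset.mem_Ioc,
    Finset.mem_Ico] at hx
  obtain ⟨q, ⟨h1, h2⟩, a, ⟨⟨h3, h4⟩, h5⟩, h6⟩ := hx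
  exact ⟨q, a, h1, h2, h3, h4, h5, h6.symm⟩

lemma fibre_bound (Q D : ℕ) (hQ : 4 ≤ Q)
    (hD : ∀ n : ℕ, n ≠ 0 → n ≤ 4 * Q ^ 2 → n.divisors.card ≤ D) (x' : ℚ) (hx' : x' ∈ SQ Q)
    (N : ℕ)
    (hN : N = ((SQ Q).filter fun x : ℚ => 2 * dist01 ((x : ℝ) - (x' : ℝ)) < 1/(Q:ℝ)^3).card) :
    N * N ≤ N + D * (288 * Q) := by
  obtain ⟨q', a', h1, h2, h3, h4, h5, h6⟩ := mem_SQ hx'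
  set F := ((SQ Q).filter fun x : ℚ => 2 * dist01 ((x : ℝ) - (x' : ℝ)) < 1/(Q:ℝ)^3) with hF
  have hex : ∀ x : ℚ, x ∈ F → ∃ q a : ℕ, Q < q ∧ q ≤ 2 * Q ∧ 1 ≤ a ∧ a < q ^ 2 ∧
    Nat.gcd a q = 1 ∧ x = (a : ℚ) / (q : ℚ) ^ 2 := fun x hx => mem_SQ (Finset.mem_filter.1 hx).1
  choose! q a hq using hex
  have hQR : (4 : ℝ) ≤ Q := by exact_mod_cast hQ
  have hQ0 : (0 : ℝ) < Q := by linarith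
  -- closeness
  have hclose : ∀ x : ℚ, x ∈ F → ∃ k : ℤ, |(x : ℝ) - x' - k| < 1 / (2 * (Q : ℝ) ^ 3) := by
    intro x hx
    have := (Finset.mem_filter.1 hx).2
    refine ⟨round ((x : ℝ) - x'), ?_⟩
    rw [dist01] at this
    have e : 1 / (2 * (Q : ℝ) ^ 3) = (1 / (Q : ℝ) ^ 3) / 2 := by field_simp
    rw [e]
    linarith
  have hinj : Set.InjOn q F := by
    intro x hx y hy hxy
    obtain ⟨x1, x2, x3, x4, x5, x6⟩ := hq x hx
    obtain ⟨y1, y2, y3, y4, y5, y6⟩ := hq y hy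
    obtain ⟨k, hk⟩ := hclose x hx
    obtain ⟨l, hl⟩ := hclose y hy
    rw [← hxy] at y1 y2 y4 y6
    have hqpos : (0 : ℝ) < q x := by
      have : 0 < q x := by omega
      exact_mod_cast this
    have hd : |(x : ℝ) - y - (k - l : ℤ)| < 1 / (Q : ℝ) ^ 3 := by
      have e : (x : ℝ) - y - (k - l : ℤ) = ((x : ℝ) - x' - k) - ((y : ℝ) - x' - l) := by
        push_cast; ring
      have e2 : 1 / (Q : ℝ) ^ 3 = 1 / (2 * (Q : ℝ) ^ 3) + 1 / (2 * (Q : ℝ) ^ 3) := by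
        field_simp; norm_num
      rw [e, e2]
      exact (abs_sub _ _).trans_lt (add_lt_add hk hl)
    have hm : |(((a x : ℤ) - a y - (k - l) * (q x : ℤ) ^ 2 : ℤ) : ℝ)| < 1 := by
      have e : (((a x : ℤ) - a y - (k - l) * (q x : ℤ) ^ 2 : ℤ) : ℝ)
          = ((x : ℝ) - y - (k - l : ℤ)) * (q x : ℝ) ^ 2 := by
        have ex : (x : ℝ) = (a x : ℝ) / (q x : ℝ) ^ 2 := by
          conv_lhs => rw [x6]
          push_cast; rfl
        have ey : (y : ℝ) = (a y : ℝ) / (q x : ℝ) ^ 2 := by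
          conv_lhs => rw [y6]
          push_cast; rfl
        rw [ex, ey]
        push_cast
        field_simp
      rw [e, abs_mul, abs_of_pos (by positivity : (0 : ℝ) < (q x : ℝ) ^ 2)]
      have hq2 : (q x : ℝ) ≤ 2 * Q := by exact_mod_cast x2
      calc _ < 1 / (Q : ℝ) ^ 3 * (q x : ℝ) ^ 2 := by gcongr
        _ ≤ 1 / (Q : ℝ) ^ 3 * (2 * Q) ^ 2 := by gcongr
        _ = 4 / Q := by field_simp; norm_num
        _ ≤ 1 := by rw [div_le_one hQ0]; exact hQR
    have hm' : (a x : ℤ) - a y - (k - l) * (q x : ℤ) ^ 2 = 0 := by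
      rw [← Int.abs_lt_one_iff]
      exact_mod_cast hm
    have hmod : a x = a y := by
      have : (a x : ℤ) ≡ a y [ZMOD ((q x ^ 2 : ℕ) : ℤ)] := by
        apply Int.ModEq.symm
        rw [Int.modEq_iff_dvd]
        exact ⟨k - l, by push_cast; linarith⟩
      have h := (Int.natCast_modEq_iff).1 this
      exact Nat.ModEq.eq_of_lt_of_lt h x4 y4
    rw [x6, y6, hmod]
  have hc := core Q D (by omega) (a' : ℤ) ((q' : ℤ) ^ 2) (by
      have : (Q : ℤ) < q' := by exact_mod_cast h1
      nlinarith) (by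
      have : (q' : ℤ) ≤ 2 * Q := by exact_mod_cast h2
      nlinarith) (by
      apply IsCoprime.pow_left
      rw [Nat.isCoprime_iff_coprime]
      exact Nat.Coprime.symm h5) (F.image q) (by
      intro n hn
      obtain ⟨x, hx, rfl⟩ := Finset.mem_image.1 hn
      exact Finset.mem_Ioc.2 ⟨(hq x hx).1, (hq x hx).2.1⟩) (by
      intro n hn
      obtain ⟨x, hx, rfl⟩ := Finset.mem_image.1 hn
      obtain ⟨x1, x2, x3, x4, x5, x6⟩ := hq x hx
      obtain ⟨k, hk⟩ := hclose x hx
      refine ⟨a x - k * (q x : ℤ) ^ 2, ?_⟩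
      have hqpos : (0 : ℝ) < q x := by
        have : 0 < q x := by omega
        exact_mod_cast this
      have hqpos' : (0 : ℝ) < q' := by
        have : 0 < q' := by omega
        exact_mod_cast this
      have hq2 : (q x : ℝ) ≤ 2 * Q := by exact_mod_cast x2
      have e : (((a x : ℝ) - k * (q x : ℝ) ^ 2) * (q' : ℝ) ^ 2 - a' * (q x : ℝ) ^ 2)
          = ((x : ℝ) - x' - k) * ((q x : ℝ) ^ 2 * (q' : ℝ) ^ 2) := by
        have ex : (x : ℝ) = (a x : ℝ) / (q x : ℝ) ^ 2 := by
          conv_lhs => rw [x6]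
          push_cast; rfl
        have ey : (x' : ℝ) = (a' : ℝ) / (q' : ℝ) ^ 2 := by
          conv_lhs => rw [h6]
          push_cast; rfl
        rw [ex, ey]
        field_simp
        ring
      have hfin : |(((a x : ℝ) - k * (q x : ℝ) ^ 2) * (q' : ℝ) ^ 2 - a' * (q x : ℝ) ^ 2)| * Q
          < 2 * (q' : ℝ) ^ 2 := by
        rw [e, abs_mul, abs_of_pos (by positivity : (0 : ℝ) < (q x : ℝ) ^ 2 * (q' : ℝ) ^ 2)]
        calc _ < 1 / (2 * (Q : ℝ) ^ 3) * ((q x : ℝ) ^ 2 * (q' : ℝ) ^ 2) * Q := by gcongr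
          _ ≤ 1 / (2 * (Q : ℝ) ^ 3) * ((2 * Q) ^ 2 * (q' : ℝ) ^ 2) * Q := by gcongr
          _ = 2 * (q' : ℝ) ^ 2 := by field_simp
      exact_mod_cast hfin) hD
  rw [Finset.card_image_of_injOn hinj, ← hN] at hc
  exact hc

theorem stmt12 : ∀ ε : ℝ, ε > 0 → ∃ C : ℝ, C > 0 ∧ ∀ Q : ℕ, 0 < Q →
    (MQ Q : ℝ) ≤ C * (Q:ℝ) ^ ((1:ℝ)/2 + ε) := by
  intro ε hε
  obtain ⟨C, hC, hdiv⟩ := divisor_bound ε hε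
  set E : ℝ := C * 4 ^ ε * 288 with hE
  have hE0 : 0 < E := by positivity
  refine ⟨(MQ 1 + MQ 2 + MQ 3 : ℕ) + 1 + √E, by positivity, fun Q hQ => ?_⟩
  have hQ1 : (1 : ℝ) ≤ Q := by exact_mod_cast hQ
  have hQ0 : (0 : ℝ) < Q := by linarith
  set X : ℝ := (Q:ℝ) ^ ((1:ℝ)/2 + ε) with hX
  have hX1 : 1 ≤ X := Real.one_le_rpow hQ1 (by positivity)
  have hs : 0 ≤ √E := Real.sqrt_nonneg E
  by_cases h4 : 4 ≤ Q
  · have hcases : MQ Q = 0 ∨ ∃ x' ∈ SQ Q, MQ Q =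
        ((SQ Q).filter fun x : ℚ => 2 * dist01 ((x : ℝ) - (x' : ℝ)) < 1/(Q:ℝ)^3).card := by
      by_cases hne : (SQ Q).Nonempty
      · right
        obtain ⟨x', hx', h⟩ := Finset.exists_mem_eq_sup (SQ Q) hne (fun x' =>
          ((SQ Q).filter fun x : ℚ => 2 * dist01 ((x : ℝ) - (x' : ℝ)) < 1/(Q:ℝ)^3).card)
        refine ⟨x', hx', ?_⟩
        rw [← h, MQ]
        congr 1
        funext y
        exact card_filter_cast (SQ Q) (fun x : ℝ => 2 * dist01 (x - (y : ℝ)) < 1/(Q:ℝ)^3)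
      · left
        rw [Finset.not_nonempty_iff_eq_empty] at hne
        simp [MQ, hne]
    rcases hcases with h0 | ⟨x', hx', hM⟩
    · rw [h0]
      push_cast
      positivity
    set D : ℕ := ⌊C * (4 * (Q : ℝ) ^ 2) ^ ε⌋₊ with hDdef
    have hDle : (D : ℝ) ≤ C * (4 * (Q : ℝ) ^ 2) ^ ε := Nat.floor_le (by positivity)
    have hb := fibre_bound Q D h4 (by
      intro n hn hn4
      apply Nat.le_floor
      refine (hdiv n hn).trans ?_
      gcongr
      exact_mod_cast hn4) x' hx' _ hM
    set N := MQ Q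
    have hb' : (N : ℝ) * N ≤ N + D * (288 * Q) := by exact_mod_cast hb
    have hEX : D * (288 * (Q : ℝ)) ≤ (√E * X) ^ 2 := by
      have e : (√E * X) ^ 2 = C * (4 * (Q : ℝ) ^ 2) ^ ε * (288 * Q) := by
        rw [mul_pow, Real.sq_sqrt hE0.le, hX, ← Real.rpow_natCast, ← Real.rpow_mul hQ0.le,
          Real.mul_rpow (by norm_num) (by positivity), ← Real.rpow_natCast (Q : ℝ) 2,
          ← Real.rpow_mul hQ0.le]
        have : ((1 : ℝ) / 2 + ε) * ((2 : ℕ) : ℝ) = ((2 : ℕ) : ℝ) * ε + 1 := by push_cast; ring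
        rw [this, Real.rpow_add hQ0, Real.rpow_one, hE]
        ring
      rw [e]
      gcongr
    have hfin : (N : ℝ) ≤ 1 + √E * X := by
      by_contra hcon
      push Not at hcon
      have : 0 ≤ √E * X := by positivity
      nlinarith
    have : (0 : ℝ) ≤ (MQ 1 + MQ 2 + MQ 3 : ℕ) := by positivity
    nlinarith
  · have hle : MQ Q ≤ MQ 1 + MQ 2 + MQ 3 := by
      have : Q = 1 ∨ Q = 2 ∨ Q = 3 := by omega
      rcases this with rfl | rfl | rfl <;> omega
    have hle' : (MQ Q : ℝ) ≤ (MQ 1 + MQ 2 + MQ 3 : ℕ) := by exact_mod_cast hle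
    have : (0 : ℝ) ≤ (MQ 1 + MQ 2 + MQ 3 : ℕ) := by positivity
    nlinarith
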